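/- The function Fin : ℙ → ℙ (Fin(x) = {0} if x is finite, ∅ otherwise) is not (𝒰 ∪ {ε})-definable. Moreover, no (𝒰 ∪ {ε})-definable function F : ℙ → ℙ satisfies, for all finite non-empty t ⊆ ℕ, any one of the following: (a) F(t) = {0} if |t| is even and ∅ otherwise; (b) F(t) = {0} if max(t) is even and ∅ otherwise; (c) F(t) = {0} if Σ_{n∈t} n is even and ∅ otherwise. -/

import Mathlib

noncomputable section
open Classical

/-- `s ⊕ t`: lifted addition on sets of naturals. -/
def setPlus (s t : Set ℕ) : Set ℕ := {u | ∃ m ∈ s, ∃ n ∈ t, u = m + n}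

/-- `s ⊗ t`: lifted multiplication on sets of naturals. -/
def setTimes (s t : Set ℕ) : Set ℕ := {u | ∃ m ∈ s, ∃ n ∈ t, u = m * n}

/-- Sets of naturals definable by (variable-free) arithmetic circuits:
the smallest collection containing `∅`, `ℕ`, all singletons, closed under
union, intersection, complement, `⊕` and `⊗`. -/
inductive ArithDefinable : Set ℕ → Prop
  | empty : ArithDefinable ∅
  | univ : ArithDefinable Set.univ
  | single (k : ℕ) : ArithDefinable {k}
  | union : ∀ {s t : Set ℕ}, ArithDefinable s → ArithDefinable t → ArithDefinable (s ∪ t)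
  | inter : ∀ {s t : Set ℕ}, ArithDefinable s → ArithDefinable t → ArithDefinable (s ∩ t)
  | compl : ∀ {s : Set ℕ}, ArithDefinable s → ArithDefinable sᶜ
  | plus : ∀ {s t : Set ℕ}, ArithDefinable s → ArithDefinable t → ArithDefinable (setPlus s t)
  | times : ∀ {s t : Set ℕ}, ArithDefinable s → ArithDefinable t → ArithDefinable (setTimes s t)

/-- A set-function of arity `k`. -/
abbrev SetFun (k : ℕ) := (Fin k → Set ℕ) → Set ℕ

/-- The `𝒪`-definable functions `ℙ^n → ℙ`, for a collection `O` of set-functions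
(given per arity): smallest class containing projections and the constants
`∅`, `ℕ`, `{k}`, closed under pointwise union, intersection, complement, and
composition with functions in `O`. -/
inductive ODef (O : ∀ k, Set (SetFun k)) (n : ℕ) : SetFun n → Prop
  | proj (i : Fin n) : ODef O n (fun s => s i)
  | empty : ODef O n (fun _ => ∅)
  | univ : ODef O n (fun _ => Set.univ)
  | single (k : ℕ) : ODef O n (fun _ => {k})
  | union : ∀ {F G : SetFun n}, ODef O n F → ODef O n G → ODef O n (fun s => F s ∪ G s)
  | inter : ∀ {F G : SetFun n}, ODef O n F → ODef O n G → ODef O n (fun s => F s ∩ G s)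
  | compl : ∀ {F : SetFun n}, ODef O n F → ODef O n (fun s => (F s)ᶜ)
  | comp : ∀ {k : ℕ} {g : SetFun k} {F : Fin k → SetFun n},
      g ∈ O k → (∀ i, ODef O n (F i)) → ODef O n (fun s => g (fun i => F i s))

/-- `s_{|m} = s ∩ {0,…,m}`. -/
def restrict (s : Set ℕ) (m : ℕ) : Set ℕ := s ∩ {k | k ≤ m}

/-- `F` is `h`-continuous on `D`. -/
def HCont (h : ℕ → ℕ) {n : ℕ} (F : SetFun n) (D : Set (Fin n → Set ℕ)) : Prop :=
  ∀ m : ℕ, ∀ s ∈ D, ∀ t ∈ D,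
    (∀ i, restrict (s i) (h m) = restrict (t i) (h m)) →
    restrict (F s) m = restrict (F t) m

/-- `F` is uniformly continuous on `D`. -/
def UnifCont {n : ℕ} (F : SetFun n) (D : Set (Fin n → Set ℕ)) : Prop :=
  ∃ h : ℕ → ℕ, HCont h F D

/-- `𝒰`: set-functions (of arity `k`) uniformly continuous on the whole space. -/
def Ucal (k : ℕ) : Set (SetFun k) := {g | UnifCont g Set.univ}

/-- `𝒫`: predicates, i.e. set-functions with values among `∅` and `{0}`. -/
def Pcal (k : ℕ) : Set (SetFun k) := {g | ∀ s, g s = ∅ ∨ g s = {0}}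

/-- `𝒰 ∪ 𝒫`. -/
def UPcal (k : ℕ) : Set (SetFun k) := Ucal k ∪ Pcal k

/-- `Max(x)`. -/
def MaxFun (x : Set ℕ) : Set ℕ :=
  if x = ∅ then ∅ else if x.Infinite then Set.univ else {sSup x}

/-- `Card(x)`. -/
def CardFun (x : Set ℕ) : Set ℕ := if x.Finite then {x.ncard} else Set.univ

/-- `↓(x)`. -/
def DownFun (x : Set ℕ) : Set ℕ := {m | ∃ n ∈ x, m ≤ n}

/-- `Sum(x)`. -/
def SumFun (x : Set ℕ) : Set ℕ := if x.Finite then {∑ᶠ n ∈ x, n} else Set.univ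

/-- `Prod(x)`. -/
def ProdFun (x : Set ℕ) : Set ℕ := if x.Finite then {∏ᶠ n ∈ x, n} else Set.univ

/-- `Shove(x) = {n - min x : n ∈ x}` (empty for `x = ∅`). -/
def ShoveFun (x : Set ℕ) : Set ℕ := (fun n => n - sInf x) '' x

/-- `ε(x)`: the test for emptiness. -/
def epsFun (x : Set ℕ) : Set ℕ := if x = ∅ then {0} else ∅

/-- `Fin(x)`: the test for finiteness. -/
def FinFun (x : Set ℕ) : Set ℕ := if x.Finite then {0} else ∅

/-- `⊕` as a set-function of arity 2. -/
def plusFun : SetFun 2 := fun s => setPlus (s 0) (s 1)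

/-- `⊗` as a set-function of arity 2. -/
def timesFun : SetFun 2 := fun s => setTimes (s 0) (s 1)

/-- `↓` as a set-function of arity 1. -/
def downFun1 : SetFun 1 := fun s => DownFun (s 0)

/-- `ε` as a set-function of arity 1. -/
def epsFun1 : SetFun 1 := fun s => epsFun (s 0)

/-- The collection `{⊕, ⊗}`. -/
def arithO : ∀ k, Set (SetFun k)
  | 2 => {plusFun, timesFun}
  | _ => ∅

/-- The collection `{⊕}`. -/
def addO : ∀ k, Set (SetFun k)
  | 2 => {plusFun}
  | _ => ∅

/-- The collection `{⊕, ↓} ∪ 𝒫`. -/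
def addDownO : ∀ k, Set (SetFun k)
  | 1 => insert downFun1 (Pcal 1)
  | 2 => insert plusFun (Pcal 2)
  | k => Pcal k

/-- The collection `{⊕, ⊗, ↓} ∪ 𝒫`. -/
def arithDownO : ∀ k, Set (SetFun k)
  | 1 => insert downFun1 (Pcal 1)
  | 2 => {plusFun, timesFun} ∪ Pcal 2
  | k => Pcal k

/-- The collection `𝒰 ∪ {ε}`. -/
def UEps : ∀ k, Set (SetFun k)
  | 1 => insert epsFun1 (Ucal 1)
  | k => Ucal k

/-- The collection `{⊕, ⊗} ∪ 𝒫`. -/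
def arithPO (k : ℕ) : Set (SetFun k) := arithO k ∪ Pcal k

/-- A numerical function `ℕ → ℕ` is `O`-definable if some `O`-definable
set-function maps `{m}` to `{f m}` for every `m`. -/
def NumDef1 (O : ∀ k, Set (SetFun k)) (f : ℕ → ℕ) : Prop :=
  ∃ F : SetFun 1, ODef O 1 F ∧ ∀ m : ℕ, F (fun _ => {m}) = {f m}

/-- A numerical function `ℕ^k → ℕ` is `O`-definable if some `O`-definable
set-function maps tuples of singletons to the corresponding singleton value. -/
def NumDef (O : ∀ k, Set (SetFun k)) (k : ℕ) (f : (Fin k → ℕ) → ℕ) : Prop :=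
  ∃ F : SetFun k, ODef O k F ∧ ∀ m : Fin k → ℕ, F (fun i => ({m i} : Set ℕ)) = {f m}

/-- `f` is regressive: `{f n : f n < n}` is infinite. -/
def Regressive (f : ℕ → ℕ) : Prop := {y | ∃ n, f n = y ∧ y < n}.Infinite

/-- `f` is semi-regressive: for every `ℓ` there is `n` with `n + ℓ ≤ f n ≤ 2n - 2`. -/
def SemiRegressive (f : ℕ → ℕ) : Prop :=
  ∀ ℓ : ℕ, ∃ n : ℕ, n + ℓ ≤ f n ∧ (f n : ℤ) ≤ 2 * (n : ℤ) - 2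

/-- The basic clopen set of tuples agreeing with `s` on `{0,…,m}`. -/
def cylinder {n : ℕ} (s : Fin n → Set ℕ) (m : ℕ) : Set (Fin n → Set ℕ) :=
  {t | ∀ i, restrict (t i) m = restrict (s i) m}

lemma restrict_eq_iff {s t : Set ℕ} {m : ℕ} :
    restrict s m = restrict t m ↔ ∀ k ≤ m, (k ∈ s ↔ k ∈ t) := by
  simp only [restrict, Set.ext_iff, Set.mem_inter_iff, Set.mem_ofPred_eq]
  constructor
  · intro h k hk
    simpa [hk] using h k
  · intro h k
    by_cases hk : k ≤ m
    · simp [hk, h k hk]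
    · simp [hk]

lemma restrict_eq_mono {s t : Set ℕ} {m k : ℕ} (hmk : m ≤ k)
    (h : restrict s k = restrict t k) : restrict s m = restrict t m := by
  rw [restrict_eq_iff] at h ⊢
  exact fun j hj => h j (hj.trans hmk)

lemma mem_cylinder_self {n : ℕ} (s : Fin n → Set ℕ) (m : ℕ) : s ∈ cylinder s m :=
  fun _ => rfl

lemma cylinder_subset {n : ℕ} {s t : Fin n → Set ℕ} {m k : ℕ} (hmk : m ≤ k)
    (ht : t ∈ cylinder s m) : cylinder t k ⊆ cylinder s m :=
  fun _ hu i => (restrict_eq_mono hmk (hu i)).trans (ht i)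

lemma UnifCont.mono {n : ℕ} {F : SetFun n} {D E : Set (Fin n → Set ℕ)} (hF : UnifCont F E)
    (hDE : D ⊆ E) : UnifCont F D := by
  obtain ⟨h, hh⟩ := hF
  exact ⟨h, fun m s hs t ht => hh m s (hDE hs) t (hDE ht)⟩

lemma unifCont_of_const {n : ℕ} {F : SetFun n} {D : Set (Fin n → Set ℕ)} {c : Set ℕ}
    (hF : ∀ s ∈ D, F s = c) : UnifCont F D :=
  ⟨id, fun m s hs t ht _ => by rw [hF s hs, hF t ht]⟩

lemma UnifCont.comp {n k : ℕ} {g : SetFun k} {F : Fin k → SetFun n} {D : Set (Fin n → Set ℕ)}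
    (hg : UnifCont g Set.univ) (hF : ∀ i, UnifCont (F i) D) :
    UnifCont (fun s => g (fun i => F i s)) D := by
  obtain ⟨h, hh⟩ := hg
  choose f hf using hF
  refine ⟨fun m => Finset.univ.sup fun i => f i (h m), fun m s hs t ht hst =>
    hh m _ trivial _ trivial fun i => hf i _ s hs t ht fun j => ?_⟩
  exact restrict_eq_mono (Finset.le_sup (f := fun i => f i (h m)) (Finset.mem_univ i)) (hst j)

/-- Every cylinder contains a subcylinder on which `F` is uniformly continuous. -/
def DenselyUnifCont {n : ℕ} (F : SetFun n) : Prop :=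
  ∀ s m, ∃ t k, cylinder t k ⊆ cylinder s m ∧ UnifCont F (cylinder t k)

lemma UnifCont.densely {n : ℕ} {F : SetFun n} (hF : UnifCont F Set.univ) :
    DenselyUnifCont F :=
  fun s m => ⟨s, m, subset_rfl, hF.mono (Set.subset_univ _)⟩

lemma DenselyUnifCont.exists_common {n k : ℕ} {F : Fin k → SetFun n}
    (hF : ∀ i, DenselyUnifCont (F i)) (s : Fin n → Set ℕ) (m : ℕ) :
    ∃ t l, cylinder t l ⊆ cylinder s m ∧ ∀ i, UnifCont (F i) (cylinder t l) := by
  induction k with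
  | zero => exact ⟨s, m, subset_rfl, fun i => i.elim0⟩
  | succ k ih =>
    obtain ⟨t, l, htl, ht⟩ := ih fun i => hF i.succ
    obtain ⟨u, j, huj, hu⟩ := hF 0 t l
    exact ⟨u, j, huj.trans htl, Fin.forall_fin_succ.2 ⟨hu, fun i => (ht i).mono huj⟩⟩

lemma DenselyUnifCont.comp {n k : ℕ} {g : SetFun k} {F : Fin k → SetFun n}
    (hg : UnifCont g Set.univ) (hF : ∀ i, DenselyUnifCont (F i)) :
    DenselyUnifCont (fun s => g (fun i => F i s)) := by
  intro s m
  obtain ⟨t, l, htl, ht⟩ := DenselyUnifCont.exists_common hF s m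
  exact ⟨t, l, htl, hg.comp ht⟩

lemma DenselyUnifCont.eps {n : ℕ} {F : SetFun n} (hF : DenselyUnifCont F) :
    DenselyUnifCont (fun s => epsFun (F s)) := by
  intro s m
  obtain ⟨t, l, htl, h, hh⟩ := hF s m
  by_cases hne : ∃ u ∈ cylinder t l, (F u).Nonempty
  · obtain ⟨u, hu, a, ha⟩ := hne
    have hsub : cylinder u (max l (h a)) ⊆ cylinder t l := cylinder_subset (le_max_left _ _) hu
    refine ⟨u, max l (h a), hsub.trans htl, unifCont_of_const (c := ∅) fun v hv => ?_⟩
    have hav := hh a v (hsub hv) u hu fun i => restrict_eq_mono (le_max_right _ _) (hv i)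
    have hmem : a ∈ F v := (restrict_eq_iff.1 hav a le_rfl).2 ha
    exact if_neg (Set.Nonempty.ne_empty ⟨a, hmem⟩)
  · refine ⟨t, l, htl, unifCont_of_const (c := {0}) fun v hv => ?_⟩
    exact if_pos (Set.not_nonempty_iff_eq_empty.1 fun hv' => hne ⟨v, hv, hv'⟩)

lemma unifCont_union : UnifCont (fun v : Fin 2 → Set ℕ => v 0 ∪ v 1) Set.univ :=
  ⟨id, fun m s _ t _ h => by
    simp only [id, restrict_eq_iff, Set.mem_union] at h ⊢
    exact fun k hk => or_congr (h 0 k hk) (h 1 k hk)⟩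

lemma unifCont_inter : UnifCont (fun v : Fin 2 → Set ℕ => v 0 ∩ v 1) Set.univ :=
  ⟨id, fun m s _ t _ h => by
    simp only [id, restrict_eq_iff, Set.mem_inter_iff] at h ⊢
    exact fun k hk => and_congr (h 0 k hk) (h 1 k hk)⟩

lemma unifCont_compl : UnifCont (fun v : Fin 1 → Set ℕ => (v 0)ᶜ) Set.univ :=
  ⟨id, fun m s _ t _ h => by
    simp only [id, restrict_eq_iff, Set.mem_compl_iff] at h ⊢
    exact fun k hk => not_congr (h 0 k hk)⟩

lemma ODef.denselyUnifCont {n : ℕ} {F : SetFun n} (hF : ODef UEps n F) :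
    DenselyUnifCont F := by
  induction hF with
  | proj i => exact UnifCont.densely ⟨id, fun m s _ t _ h => h i⟩
  | empty => exact (unifCont_of_const fun _ _ => rfl).densely
  | univ => exact (unifCont_of_const fun _ _ => rfl).densely
  | single k => exact (unifCont_of_const fun _ _ => rfl).densely
  | @union F G _ _ hF hG =>
    exact DenselyUnifCont.comp (F := ![F, G]) unifCont_union (Fin.forall_fin_two.2 ⟨hF, hG⟩)
  | @inter F G _ _ hF hG =>
    exact DenselyUnifCont.comp (F := ![F, G]) unifCont_inter (Fin.forall_fin_two.2 ⟨hF, hG⟩)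
  | @compl F _ hF =>
    exact DenselyUnifCont.comp (F := fun _ => F) unifCont_compl fun _ => hF
  | @comp k g F hg _ hF =>
    match k, g, F, hg, hF with
    | 0, _, _, hg, hF => exact DenselyUnifCont.comp hg hF
    | 1, _, _, Or.inl rfl, hF => exact (hF 0).eps
    | 1, _, _, Or.inr hg, hF => exact DenselyUnifCont.comp hg hF
    | _ + 2, _, _, hg, hF => exact DenselyUnifCont.comp hg hF

/-- Membership of `0` in `F` is insensitive to elements above `M`, for sets that start
like `t`. -/
lemma ODef.exists_finset_zero_mem_iff {F : SetFun 1} (hF : ODef UEps 1 F) :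
    ∃ (t : Finset ℕ) (M : ℕ), (∀ k ∈ t, k ≤ M) ∧ ∀ u v : Set ℕ, (∀ k ∈ u, M < k) →
      (∀ k ∈ v, M < k) → (0 ∈ F (fun _ => ↑t ∪ u) ↔ 0 ∈ F (fun _ => ↑t ∪ v)) := by
  obtain ⟨s, m, -, h, hh⟩ := hF.denselyUnifCont (fun _ => ∅) 0
  let M := max m (h 0)
  refine ⟨(Finset.range (M + 1)).filter (· ∈ s 0), M, ?_, fun u v hu hv => ?_⟩
  · intro k hk
    simp only [Finset.mem_filter, Finset.mem_range] at hk
    lia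
  have agree : ∀ w : Set ℕ, (∀ k ∈ w, M < k) → ∀ i : Fin 1,
      restrict (↑((Finset.range (M + 1)).filter (· ∈ s 0)) ∪ w) M = restrict (s i) M := by
    intro w hw i
    rw [Subsingleton.elim i 0, restrict_eq_iff]
    intro k hk
    have hkw : k ∉ w := fun hk' => (hw k hk').not_ge hk
    simpa [hkw] using fun _ => hk
  have key := hh 0 (fun _ => ↑((Finset.range (M + 1)).filter (· ∈ s 0)) ∪ u)
    (fun i => restrict_eq_mono (le_max_left _ _) (agree u hu i))
    (fun _ => ↑((Finset.range (M + 1)).filter (· ∈ s 0)) ∪ v)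
    (fun i => restrict_eq_mono (le_max_left _ _) (agree v hv i))
    (fun i => restrict_eq_mono (le_max_right _ _) ((agree u hu i).trans (agree v hv i).symm))
  exact restrict_eq_iff.1 key 0 le_rfl

lemma zero_mem_ite_iff {p : Prop} [Decidable p] :
    0 ∈ (if p then ({0} : Set ℕ) else ∅) ↔ p := by
  split_ifs with h <;> simp [h]

lemma csSup_insert_of_forall_le {t : Finset ℕ} {a : ℕ} (h : ∀ k ∈ t, k ≤ a) :
    sSup (↑(insert a t) : Set ℕ) = a :=
  IsGreatest.csSup_eq ⟨by simp, fun k hk => by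
    rcases Finset.mem_insert.1 (Finset.mem_coe.1 hk) with rfl | hk
    exacts [le_rfl, h k hk]⟩

/-- A uniform obstruction: a `(𝒰 ∪ {ε})`-definable function cannot test a property `P` of
nonempty finite sets which two large finite extensions of any finite set disagree on. -/
lemma ODef.not_forall_eq_ite {F : SetFun 1} (hF : ODef UEps 1 F) (P : Set ℕ → Prop)
    [DecidablePred P] (hP : ∀ (t : Finset ℕ) (M : ℕ), (∀ k ∈ t, k ≤ M) → ∃ u v : Finset ℕ, u.Nonempty ∧
      v.Nonempty ∧ (∀ k ∈ u, M < k) ∧ (∀ k ∈ v, M < k) ∧ ¬ (P ↑(u ∪ t) ↔ P ↑(v ∪ t))) :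
    ¬ ∀ t : Set ℕ, t.Finite → t.Nonempty →
      F (fun _ => t) = if P t then ({0} : Set ℕ) else ∅ := by
  intro h
  obtain ⟨t, M, htM, ht⟩ := hF.exists_finset_zero_mem_iff
  obtain ⟨u, v, hu, hv, hMu, hMv, hne⟩ := hP t M htM
  have key := ht u v (by simpa using hMu) (by simpa using hMv)
  rw [← Finset.coe_union, ← Finset.coe_union, Finset.union_comm t u, Finset.union_comm t v,
    h _ (Finset.finite_toSet _) (by simpa using hu.inl),
    h _ (Finset.finite_toSet _) (by simpa using hv.inl),
    zero_mem_ite_iff, zero_mem_ite_iff] at key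
  exact hne key

theorem fin_and_parity_tests_not_UEps_definable :
    (¬ ODef UEps 1 (fun v => FinFun (v 0))) ∧
    ∀ F : SetFun 1, ODef UEps 1 F →
      (¬ ∀ t : Set ℕ, t.Finite → t.Nonempty →
          F (fun _ => t) = if Even t.ncard then ({0} : Set ℕ) else ∅) ∧
      (¬ ∀ t : Set ℕ, t.Finite → t.Nonempty →
          F (fun _ => t) = if Even (sSup t) then ({0} : Set ℕ) else ∅) ∧
      (¬ ∀ t : Set ℕ, t.Finite → t.Nonempty →
          F (fun _ => t) = if Even (∑ᶠ n ∈ t, n) then ({0} : Set ℕ) else ∅) := by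
  refine ⟨fun hF => ?_, fun F hF => ⟨hF.not_forall_eq_ite (fun t => Even t.ncard) ?_,
    hF.not_forall_eq_ite (fun t => Even (sSup t)) ?_,
    hF.not_forall_eq_ite (fun t => Even (∑ᶠ n ∈ t, n)) ?_⟩⟩
  · obtain ⟨t, M, -, ht⟩ := hF.exists_finset_zero_mem_iff
    have key := ht ∅ (Set.Ioi M) (by simp) (by simp)
    simp only [FinFun, zero_mem_ite_iff, Set.union_empty, Finset.finite_toSet, true_iff] at key
    exact Set.Ioi_infinite M (key.subset Set.subset_union_right)
  all_goals
    intro t M htM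
    have h1 : M + 1 ∉ t := fun h => by simpa using htM _ h
    have h2 : M + 2 ∉ t := fun h => by simpa using htM _ h
  · refine ⟨{M + 1}, {M + 1, M + 2}, by simp, by simp, by simp, by simp, ?_⟩
    simp only [Set.ncard_coe_finset, Finset.insert_union, Finset.singleton_union]
    rw [Finset.card_insert_of_notMem h1, Finset.card_insert_of_notMem (by simp [h1]),
      Finset.card_insert_of_notMem h2]
    grind
  · refine ⟨{M + 1}, {M + 2}, by simp, by simp, by simp, by simp, ?_⟩
    simp only [Finset.singleton_union]
    rw [csSup_insert_of_forall_le fun k hk => (htM k hk).trans (by simp),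
      csSup_insert_of_forall_le fun k hk => (htM k hk).trans (by simp)]
    grind
  · refine ⟨{M + 1}, {M + 2}, by simp, by simp, by simp, by simp, ?_⟩
    simp only [finsum_mem_coe_finset, Finset.singleton_union]
    rw [Finset.sum_insert h1, Finset.sum_insert h2]
    grind


end
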